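/- Cauchy estimates: Let f : U → ℍ be slice regular on an open set U, let I ∈ 𝕊 and q ∈ U ∩ ℂ_I, and let R > 0 be such that the closed disc B̄_I(q,R) = {s ∈ ℂ_I : |s − q| ≤ R} is contained in U ∩ ℂ_I. Then for every n ≥ 0, |(∂_s)ⁿ f(q)| ≤ (n!/Rⁿ)·max_{s ∈ ∂B_I(q,R)} |f(s)|, where ∂_s denotes the slice derivative. -/

import Mathlib

open Quaternion
open scoped InnerProductSpace Classical

/-- The sphere `𝕊` of purely imaginary unit quaternions. -/
def QSphere : Set ℍ := {q : ℍ | q ^ 2 = -1}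

/-- The complex plane `ℂ_I` through `1` and `I`. -/
def slicePlane (I : ℍ) : Set ℍ := {q : ℍ | ∃ x y : ℝ, q = (x : ℍ) + y • I}

/-- A real differentiable `f` is (left) slice regular on `U` if on every slice `U ∩ ℂ_I`
it satisfies the Cauchy-Riemann equation `∂f/∂x + I ∂f/∂y = 0`. -/
def SliceRegularOn (f : ℍ → ℍ) (U : Set ℍ) : Prop :=
  DifferentiableOn ℝ f U ∧
    ∀ I ∈ QSphere, ∀ q ∈ U ∩ slicePlane I,
      fderiv ℝ f q 1 + I * fderiv ℝ f q I = 0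

/-- The slice derivative: `∂f/∂x` at real points and `½(∂f/∂x − I_q ∂f/∂y)` at
`q = x + I_q y` with `y ≠ 0`, where `I_q = Im(q)/|Im(q)|`. -/
noncomputable def sliceDeriv (f : ℍ → ℍ) (q : ℍ) : ℍ :=
  if q.im = 0 then fderiv ℝ f q 1
  else
    (2 : ℝ)⁻¹ •
      (fderiv ℝ f q 1 - (‖q.im‖⁻¹ • q.im) * fderiv ℝ f q (‖q.im‖⁻¹ • q.im))

open Filter Topology Metric

lemma QSphere.mul_self {I : ℍ} (hI : I ∈ QSphere) : I * I = -1 := by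
  rw [← sq]
  exact hI

lemma QSphere.norm_eq_one {I : ℍ} (hI : I ∈ QSphere) : ‖I‖ = 1 := by
  have h : ‖I‖ * ‖I‖ = 1 := by rw [← norm_mul, QSphere.mul_self hI, norm_neg, norm_one]
  nlinarith [norm_nonneg I]

lemma QSphere.re_eq_zero {I : ℍ} (hI : I ∈ QSphere) : I.re = 0 := by
  have h := QSphere.mul_self hI
  have h0 := congrArg QuaternionAlgebra.re h
  have h1 := congrArg QuaternionAlgebra.imI h
  have h2 := congrArg QuaternionAlgebra.imJ h
  have h3 := congrArg QuaternionAlgebra.imK h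
  simp only [Quaternion.re_mul, Quaternion.imI_mul, Quaternion.imJ_mul, Quaternion.imK_mul,
    Quaternion.re_neg, Quaternion.imI_neg, Quaternion.imJ_neg, Quaternion.imK_neg,
    Quaternion.re_one, Quaternion.imI_one, Quaternion.imJ_one, Quaternion.imK_one] at h0 h1 h2 h3
  by_contra hre
  have e1 : I.imI = 0 := by
    have : I.re * I.imI = 0 := by linarith
    simpa [hre] using this
  have e2 : I.imJ = 0 := by
    have : I.re * I.imJ = 0 := by linarith
    simpa [hre] using this
  have e3 : I.imK = 0 := by
    have : I.re * I.imK = 0 := by linarith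
    simpa [hre] using this
  simp only [e1, e2, e3] at h0
  nlinarith [mul_self_nonneg I.re]

/-- The embedding `x + iy ↦ x + Iy` of `ℂ` onto the plane `ℂ_I`. -/
noncomputable def sliceEmbedding {I : ℍ} (hI : I ∈ QSphere) : ℂ →ₐ[ℝ] ℍ :=
  Complex.lift ⟨I, QSphere.mul_self hI⟩

section Slice

variable {I : ℍ} (hI : I ∈ QSphere)

lemma sliceEmbedding_apply (z : ℂ) : sliceEmbedding hI z = (z.re : ℍ) + z.im • I := by
  simp [sliceEmbedding, Complex.liftAux_apply]

lemma sliceEmbedding_I : sliceEmbedding hI Complex.I = I := by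
  simp [sliceEmbedding_apply]

lemma sliceEmbedding_im (z : ℂ) : (sliceEmbedding hI z).im = z.im • I := by
  rw [sliceEmbedding_apply]
  ext <;> simp [QSphere.re_eq_zero hI]

lemma norm_sliceEmbedding (z : ℂ) : ‖sliceEmbedding hI z‖ = ‖z‖ := by
  have hstar : star I = -I := by
    ext <;> simp [QSphere.re_eq_zero hI]
  have h : sliceEmbedding hI z * star (sliceEmbedding hI z) = ((z.re ^ 2 + z.im ^ 2 : ℝ) : ℍ) := by
    have hs : star (sliceEmbedding hI z) = sliceEmbedding hI (star z) := by
      simp [sliceEmbedding_apply, hstar]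
    rw [hs, ← map_mul, Complex.star_def, Complex.mul_conj, Complex.normSq_apply,
      sliceEmbedding_apply]
    simp [sq]
  have h2 : ‖sliceEmbedding hI z‖ * ‖sliceEmbedding hI z‖ = z.re ^ 2 + z.im ^ 2 := by
    have := congrArg norm h
    rw [norm_mul, norm_star, Quaternion.norm_coe, Real.norm_of_nonneg (by positivity)] at this
    exact this
  have h3 : ‖z‖ * ‖z‖ = z.re ^ 2 + z.im ^ 2 := by
    rw [Complex.norm_mul_self_eq_normSq, Complex.normSq_apply]
    ring
  exact (mul_self_inj (norm_nonneg _) (norm_nonneg _)).1 (h2.trans h3.symm)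

/-- `sliceEmbedding` as a continuous real-linear map. -/
noncomputable def sliceEmbeddingL : ℂ →L[ℝ] ℍ :=
  LinearMap.toContinuousLinearMap (sliceEmbedding hI).toLinearMap

@[simp]
lemma sliceEmbeddingL_apply (z : ℂ) : sliceEmbeddingL hI z = sliceEmbedding hI z := rfl

lemma mem_slicePlane_iff {s : ℍ} : s ∈ slicePlane I ↔ ∃ z, sliceEmbedding hI z = s := by
  constructor
  · rintro ⟨x, y, rfl⟩
    exact ⟨⟨x, y⟩, by simp [sliceEmbedding_apply]⟩
  · rintro ⟨z, rfl⟩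
    exact ⟨z.re, z.im, sliceEmbedding_apply hI z⟩

/-- The complex structure on `ℍ` given by left multiplication by elements of `ℂ_I`. -/
noncomputable abbrev sliceNormedSpace : NormedSpace ℂ ℍ :=
  { Module.compHom ℍ (sliceEmbedding hI).toRingHom with
    norm_smul_le := fun z a => by
      change ‖sliceEmbedding hI z * a‖ ≤ _
      rw [norm_mul, norm_sliceEmbedding] }

/-- The real-linear map `w ↦ w c` on `ℂ_I`. -/
noncomputable def sliceMul (c : ℍ) : ℂ →L[ℝ] ℍ :=
  ((ContinuousLinearMap.mul ℝ ℍ).flip c).comp (sliceEmbeddingL hI)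

@[simp]
lemma sliceMul_apply (c : ℍ) (w : ℂ) : sliceMul hI c w = sliceEmbedding hI w * c := rfl

lemma hasDerivAt_slice_iff {G : ℂ → ℍ} {c : ℍ} {z : ℂ} :
    letI := sliceNormedSpace hI
    HasDerivAt G c z ↔ HasFDerivAt G (sliceMul hI c) z := by
  let := sliceNormedSpace hI
  rw [hasDerivAt_iff_isLittleO, hasFDerivAt_iff_isLittleO]
  rfl

end Slice

lemma HasDerivAt.eq_or_eq_zero_of_eventually {E : Type*} [NormedAddCommGroup E] [NormedSpace ℝ E]
    {a b : ℝ → E} {a' b' : E} {x : ℝ} (ha : HasDerivAt a a' x) (hb : HasDerivAt b b' x)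
    (h : ∀ᶠ t in 𝓝 x, a t = b t ∨ a t = 0) : a' = b' ∨ a' = 0 := by
  by_cases ha' : a' = 0
  · exact Or.inr ha'
  have hab : a =ᶠ[𝓝[≠] x] b := by
    filter_upwards [ha.eventually_ne (c := 0) ha', h.filter_mono nhdsWithin_le_nhds] with t h1 h2
    exact h2.resolve_right h1
  have hab' : a =ᶠ[𝓝 x] b :=
    (ha.continuousAt.eventuallyEq_nhds_iff_eventuallyEq_nhdsNE hb.continuousAt).1 hab
  exact Or.inl (ha.unique (hb.congr_of_eventuallyEq hab'))

lemma HasFDerivAt.apply_eq_or_eq_zero_of_eventually {E F : Type*}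
    [NormedAddCommGroup E] [NormedSpace ℝ E] [NormedAddCommGroup F] [NormedSpace ℝ F]
    {a b : E → F} {a' b' : E →L[ℝ] F} {x : E} (ha : HasFDerivAt a a' x) (hb : HasFDerivAt b b' x)
    (h : ∀ᶠ y in 𝓝 x, a y = b y ∨ a y = 0) (w : E) : a' w = b' w ∨ a' w = 0 := by
  have hl : HasDerivAt (fun t : ℝ => x + t • w) w 0 := by
    simpa using ((hasDerivAt_id (0 : ℝ)).smul_const w).const_add x
  have hx : x + (0 : ℝ) • w = x := by simp
  refine HasDerivAt.eq_or_eq_zero_of_eventually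
    (HasFDerivAt.comp_hasDerivAt (0 : ℝ) (by rwa [hx]) hl)
    (HasFDerivAt.comp_hasDerivAt (0 : ℝ) (by rwa [hx]) hl) ?_
  have ht := hl.continuousAt.tendsto
  rw [hx] at ht
  exact ht.eventually h

lemma sliceDeriv_sliceEmbedding {I : ℍ} (hI : I ∈ QSphere) (h : ℍ → ℍ) (z : ℂ) :
    sliceDeriv h (sliceEmbedding hI z) =
      if z.im = 0 then fderiv ℝ h (sliceEmbedding hI z) 1
      else (2 : ℝ)⁻¹ • (fderiv ℝ h (sliceEmbedding hI z) 1 -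
        I * fderiv ℝ h (sliceEmbedding hI z) I) := by
  have hI0 : I ≠ 0 := norm_ne_zero_iff.1 (by rw [QSphere.norm_eq_one hI]; exact one_ne_zero)
  rw [sliceDeriv, sliceEmbedding_im]
  by_cases hz : z.im = 0
  · simp [hz]
  rw [if_neg (by simp [hz, hI0]), if_neg hz, norm_smul, QSphere.norm_eq_one hI, mul_one, smul_smul,
    map_smul, smul_mul_smul_comm]
  have : ‖z.im‖⁻¹ * z.im * (‖z.im‖⁻¹ * z.im) = 1 := by
    have hn : ‖z.im‖ ≠ 0 := norm_ne_zero_iff.2 hz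
    have hs : ‖z.im‖ ^ 2 = z.im ^ 2 := by simp
    field_simp
    exact hs.symm
  rw [this, one_smul]

/-- Slice differentiation of a function agreeing pointwise on `ℂ_I` with either a holomorphic
function or `0`: no differentiability is needed, since `fderiv` vanishes by default. -/
lemma sliceDeriv_eq_or_eq_zero {I : ℍ} (hI : I ∈ QSphere) {h : ℍ → ℍ} {G : ℂ → ℍ} {c : ℍ} {z : ℂ}
    (hG : HasFDerivAt G (sliceMul hI c) z)
    (hev : ∀ᶠ w in 𝓝 z, h (sliceEmbedding hI w) = G w ∨ h (sliceEmbedding hI w) = 0) :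
    sliceDeriv h (sliceEmbedding hI z) = c ∨ sliceDeriv h (sliceEmbedding hI z) = 0 := by
  rw [sliceDeriv_sliceEmbedding]
  by_cases hd : DifferentiableAt ℝ h (sliceEmbedding hI z)
  swap
  · simp [fderiv_zero_of_not_differentiableAt hd]
  have hcomp : HasFDerivAt (fun w => h (sliceEmbedding hI w))
      ((fderiv ℝ h (sliceEmbedding hI z)).comp (sliceEmbeddingL hI)) z :=
    HasFDerivAt.comp z hd.hasFDerivAt (sliceEmbeddingL hI).hasFDerivAt
  have key := hcomp.apply_eq_or_eq_zero_of_eventually hG hev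
  have k1 := key 1
  have k2 := key Complex.I
  have k3 := key (1 + Complex.I)
  simp only [ContinuousLinearMap.comp_apply, sliceEmbeddingL_apply, sliceMul_apply, map_add,
    map_one, sliceEmbedding_I, one_mul] at k1 k2 k3
  set A := fderiv ℝ h (sliceEmbedding hI z) 1
  set B := fderiv ℝ h (sliceEmbedding hI z) I
  have hIc : I * (I * c) = -c := by rw [← mul_assoc, QSphere.mul_self hI, neg_one_mul]
  have hI0 : I ≠ 0 := norm_ne_zero_iff.1 (by rw [QSphere.norm_eq_one hI]; exact one_ne_zero)
  have hAB : (A = c ∧ B = I * c) ∨ (A = 0 ∧ B = 0) := by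
    rcases k1 with h1 | h1 <;> rcases k2 with h2 | h2
    · exact Or.inl ⟨h1, h2⟩
    · have hc : c = 0 := by simpa [h1, h2, hI0] using k3
      exact Or.inr ⟨h1.trans hc, h2⟩
    · have hc : c = 0 := by simpa [h1, h2, hI0] using k3
      exact Or.inr ⟨h1, by rw [h2, hc, mul_zero]⟩
    · exact Or.inr ⟨h1, h2⟩
  rcases hAB with ⟨h1, h2⟩ | ⟨h1, h2⟩
  · left
    rw [h1, h2, hIc]
    split_ifs
    · rfl
    · rw [sub_neg_eq_add, ← two_smul ℝ c, smul_smul]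
      norm_num
  · right
    simp [h1, h2]

lemma SliceRegularOn.hasFDerivAt_slice {f : ℍ → ℍ} {U : Set ℍ} (hf : SliceRegularOn f U)
    (hU : IsOpen U) {I : ℍ} (hI : I ∈ QSphere) {z : ℂ} (hz : sliceEmbedding hI z ∈ U) :
    HasFDerivAt (fun w => f (sliceEmbedding hI w))
      (sliceMul hI (fderiv ℝ f (sliceEmbedding hI z) 1)) z := by
  have hd := (hf.1.differentiableAt (hU.mem_nhds hz)).hasFDerivAt
  have hcr := hf.2 I hI _ ⟨hz, (mem_slicePlane_iff hI).2 ⟨z, rfl⟩⟩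
  refine (HasFDerivAt.comp z hd (sliceEmbeddingL hI).hasFDerivAt).congr_fderiv ?_
  have hB : fderiv ℝ f (sliceEmbedding hI z) I = I * fderiv ℝ f (sliceEmbedding hI z) 1 := by
    rw [eq_neg_of_add_eq_zero_left hcr, mul_neg, ← mul_assoc, QSphere.mul_self hI]
    simp
  refine ContinuousLinearMap.ext fun w => ?_
  have hw : sliceEmbedding hI w = w.re • (1 : ℍ) + w.im • I := by
    rw [sliceEmbedding_apply, ← Quaternion.coe_mul_eq_smul w.re, mul_one]
  simp only [ContinuousLinearMap.comp_apply, sliceEmbeddingL_apply, sliceMul_apply]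
  rw [hw, map_add, map_smul, map_smul, hB, add_mul, smul_mul_assoc, smul_mul_assoc, one_mul]

/-- The iterated slice derivative either equals the complex iterated derivative along the slice,
or vanishes by default where an iterate is not real differentiable. -/
lemma SliceRegularOn.iterate_sliceDeriv_eq_or_eq_zero {f : ℍ → ℍ} {U : Set ℍ}
    (hf : SliceRegularOn f U) (hU : IsOpen U) {I : ℍ} (hI : I ∈ QSphere) (n : ℕ) {z : ℂ}
    (hz : sliceEmbedding hI z ∈ U) :
    letI := sliceNormedSpace hI
    (sliceDeriv^[n] f) (sliceEmbedding hI z) =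
        iteratedDeriv n (fun w => f (sliceEmbedding hI w)) z ∨
      (sliceDeriv^[n] f) (sliceEmbedding hI z) = 0 := by
  let := sliceNormedSpace hI
  have hopen : IsOpen {w : ℂ | sliceEmbedding hI w ∈ U} :=
    hU.preimage (sliceEmbeddingL hI).continuous
  have hdiff : DifferentiableOn ℂ (fun w => f (sliceEmbedding hI w))
      {w : ℂ | sliceEmbedding hI w ∈ U} := fun w hw =>
    ((hasDerivAt_slice_iff hI).2
      (hf.hasFDerivAt_slice hU hI hw)).differentiableAt.differentiableWithinAt
  induction n generalizing z with
  | zero => simp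
  | succ n ih =>
    rw [Function.iterate_succ_apply']
    refine sliceDeriv_eq_or_eq_zero hI ((hasDerivAt_slice_iff hI).1 ?_)
      (eventually_of_mem (hopen.mem_nhds hz) fun w hw => ih hw)
    have han : AnalyticAt ℂ (fun w => f (sliceEmbedding hI w)) z :=
      hdiff.analyticAt (hopen.mem_nhds hz)
    rw [iteratedDeriv_succ]
    refine DifferentiableAt.hasDerivAt ?_
    rw [iteratedDeriv_eq_iterate]
    exact (han.iterated_deriv n).differentiableAt

/-- **Cauchy estimates.** If `f` is slice regular on an open set `U`, `q ∈ U ∩ ℂ_I` and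
the closed disc of radius `R` around `q` in `ℂ_I` is contained in `U`, then
`|∂ₛⁿ f(q)| ≤ (n!/Rⁿ) max_{s ∈ ∂B_I(q,R)} |f(s)|`. -/
theorem cauchy_estimates (U : Set ℍ) (hU : IsOpen U) (f : ℍ → ℍ)
    (hf : SliceRegularOn f U) (I : ℍ) (hI : I ∈ QSphere)
    (q : ℍ) (hq : q ∈ U ∩ slicePlane I) (R : ℝ) (hR : 0 < R)
    (hdisc : {s : ℍ | s ∈ slicePlane I ∧ ‖s - q‖ ≤ R} ⊆ U) :
    ∀ n : ℕ,
      ‖(sliceDeriv^[n] f) q‖ ≤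
        ((n.factorial : ℝ) / R ^ n) *
          sSup ((fun s : ℍ => ‖f s‖) '' {s : ℍ | s ∈ slicePlane I ∧ ‖s - q‖ = R}) := by
  intro n
  let := sliceNormedSpace hI
  obtain ⟨z, rfl⟩ := (mem_slicePlane_iff hI).1 hq.2
  have hdist (w : ℂ) : ‖sliceEmbedding hI w - sliceEmbedding hI z‖ = dist w z := by
    rw [← map_sub, norm_sliceEmbedding, dist_eq_norm]
  have hmem {w : ℂ} (hw : w ∈ closedBall z R) : sliceEmbedding hI w ∈ U :=
    hdisc ⟨(mem_slicePlane_iff hI).2 ⟨w, rfl⟩, (hdist w).trans_le hw⟩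
  have hdiff : ∀ w ∈ closedBall z R,
      DifferentiableAt ℂ (fun w => f (sliceEmbedding hI w)) w := fun w hw =>
    ((hasDerivAt_slice_iff hI).2 (hf.hasFDerivAt_slice hU hI (hmem hw))).differentiableAt
  set M := sSup ((fun s : ℍ => ‖f s‖) ''
    {s : ℍ | s ∈ slicePlane I ∧ ‖s - sliceEmbedding hI z‖ = R}) with hM
  have hM0 : 0 ≤ M := Real.sSup_nonneg (by rintro _ ⟨s, -, rfl⟩; exact norm_nonneg _)
  have himage : (fun s : ℍ => ‖f s‖) ''
      {s : ℍ | s ∈ slicePlane I ∧ ‖s - sliceEmbedding hI z‖ = R} =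
      (fun w => ‖f (sliceEmbedding hI w)‖) '' sphere z R := by
    ext r
    constructor
    · rintro ⟨s, ⟨hs, hsR⟩, rfl⟩
      obtain ⟨w, rfl⟩ := (mem_slicePlane_iff hI).1 hs
      exact ⟨w, (hdist w).symm.trans hsR, rfl⟩
    · rintro ⟨w, hw, rfl⟩
      exact ⟨_, ⟨(mem_slicePlane_iff hI).2 ⟨w, rfl⟩, (hdist w).trans hw⟩, rfl⟩
  have hbdd : BddAbove ((fun w => ‖f (sliceEmbedding hI w)‖) '' sphere z R) :=
    (isCompact_sphere z R).bddAbove_image fun w hw =>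
      (hdiff w (sphere_subset_closedBall hw)).continuousAt.norm.continuousWithinAt
  rcases hf.iterate_sliceDeriv_eq_or_eq_zero hU hI n hq.1 with h | h
  · rw [h, div_mul_eq_mul_div]
    refine Complex.norm_iteratedDeriv_le_of_forall_mem_sphere_norm_le n hR ?_ fun w hw => ?_
    · refine DifferentiableOn.diffContOnCl fun w hw => ?_
      exact (hdiff w (closure_ball_subset_closedBall hw)).differentiableWithinAt
    · rw [hM, himage]
      exact le_csSup hbdd ⟨w, hw, rfl⟩
  · rw [h, norm_zero]
    positivity
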